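/- arXiv:math/0209250 — 2 statements merged into one kernel-verified Lean document; each statement's English description precedes it below -/
import Mathlib

section
/- Let H be a topological group, G a dense subgroup of H acting on H by left translation, and let V ⊆ H be open with 1 ∈ V ⊆ X ⊆ ⋃_{s∈V} V·s⁻¹. Put V' = V ∩ G and X' = X ∩ G. Then both ψ_{V'}^{X'} : 𝐆(G,V') → 𝐆(G,X') and ψ_V^X : 𝐆(G,V) → 𝐆(G,X) are surjective. -/
open Pointwise

/-- `E(V) = {g ∈ G : V ∩ g•V ≠ ∅}`. -/
def Eset (G : Type*) {M : Type*} [Group G] [MulAction G M] (V : Set M) : Set G :=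
  {g | (V ∩ g • V).Nonempty}

/-- `F'(V) = {(g,h) : V ∩ g•V ∩ (g*h)•V ≠ ∅}`. -/
def Fset (G : Type*) {M : Type*} [Group G] [MulAction G M] (V : Set M) : Set (G × G) :=
  {p | (V ∩ p.1 • V ∩ (p.1 * p.2) • V).Nonempty}

/-- The relators `(g)(h)((g*h))⁻¹` with `(g,h) ∈ F'(V)`. -/
def relatorSet (G : Type*) {M : Type*} [Group G] [MulAction G M] (V : Set M) :
    Set (FreeGroup ↥(Eset G V)) :=
  {r | ∃ g h gh : ↥(Eset G V), ((g : G), (h : G)) ∈ Fset G V ∧ (gh : G) = (g : G) * h ∧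
       r = FreeGroup.of g * FreeGroup.of h * (FreeGroup.of gh)⁻¹}

/-- The group `𝐆(G,V)`: the free group on `E(V)` modulo the normal closure of the relators. -/
abbrev GGrp (G : Type*) {M : Type*} [Group G] [MulAction G M] (V : Set M) : Type _ :=
  FreeGroup ↥(Eset G V) ⧸ Subgroup.normalClosure (relatorSet G V)

/-- The class of a generator `g ∈ E(V)` in `𝐆(G,V)`. -/
def GGrp.gen (G : Type*) {M : Type*} [Group G] [MulAction G M] (V : Set M)
    (g : ↥(Eset G V)) : GGrp G V :=
  QuotientGroup.mk (FreeGroup.of g)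

theorem Eset_mono {G M : Type*} [Group G] [MulAction G M] {U V : Set M} (h : U ⊆ V) :
    Eset G U ⊆ Eset G V := by
  rintro g ⟨x, hx1, hx2⟩
  exact ⟨x, h hx1, Set.smul_set_mono h hx2⟩

theorem Fset_mono {G M : Type*} [Group G] [MulAction G M] {U V : Set M} (h : U ⊆ V) :
    Fset G U ⊆ Fset G V := by
  rintro ⟨g, g'⟩ ⟨x, ⟨hx1, hx2⟩, hx3⟩
  exact ⟨x, ⟨h hx1, Set.smul_set_mono h hx2⟩, Set.smul_set_mono h hx3⟩

/-- `ψ_U^V : 𝐆(G,U) → 𝐆(G,V)`, induced on generators by the inclusion `E(U) ⊆ E(V)`. -/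
def psi (G : Type*) {M : Type*} [Group G] [MulAction G M] {U V : Set M} (hUV : U ⊆ V) :
    GGrp G U →* GGrp G V :=
  QuotientGroup.lift _
    ((QuotientGroup.mk' (Subgroup.normalClosure (relatorSet G V))).comp
      (FreeGroup.map (fun g => (⟨(g : G), Eset_mono hUV g.2⟩ : ↥(Eset G V))))) <| by
    intro x hx
    set φ := (QuotientGroup.mk' (Subgroup.normalClosure (relatorSet G V))).comp
      (FreeGroup.map (fun g : ↥(Eset G U) => (⟨(g : G), Eset_mono hUV g.2⟩ : ↥(Eset G V))))
    have hsub : relatorSet G U ⊆ (φ.ker : Set (FreeGroup ↥(Eset G U))) := by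
      rintro r ⟨g, h, gh, hF, hmul, rfl⟩
      have : φ (FreeGroup.of g * FreeGroup.of h * (FreeGroup.of gh)⁻¹) = 1 := by
        simp only [φ, MonoidHom.comp_apply, map_mul, map_inv, FreeGroup.map.of]
        apply (QuotientGroup.eq_one_iff _).mpr
        apply Subgroup.subset_normalClosure
        exact ⟨_, _, _, Fset_mono hUV hF, hmul, rfl⟩
      exact this
    exact (Subgroup.normalClosure_le_normal hsub) hx

@[simp] theorem psi_gen {G M : Type*} [Group G] [MulAction G M] {U V : Set M} (hUV : U ⊆ V)
    (g : ↥(Eset G U)) :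
    psi G hUV (GGrp.gen G U g) = GGrp.gen G V ⟨(g : G), Eset_mono hUV g.2⟩ := rfl

/-- The evaluation homomorphism `ε_V : 𝐆(G,V) → G`. -/
def evalHom (G : Type*) {M : Type*} [Group G] [MulAction G M] (V : Set M) :
    GGrp G V →* G :=
  QuotientGroup.lift _ (FreeGroup.lift (fun g : ↥(Eset G V) => (g : G))) <| by
    intro x hx
    have hsub : relatorSet G V ⊆
        ((FreeGroup.lift (fun g : ↥(Eset G V) => (g : G))).ker :
          Set (FreeGroup ↥(Eset G V))) := by
      rintro r ⟨g, h, gh, hF, hmul, rfl⟩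
      have : FreeGroup.lift (fun g : ↥(Eset G V) => (g : G))
          (FreeGroup.of g * FreeGroup.of h * (FreeGroup.of gh)⁻¹) = 1 := by
        rw [map_mul, map_mul, map_inv, FreeGroup.lift_apply_of, FreeGroup.lift_apply_of,
          FreeGroup.lift_apply_of, hmul]
        group
      exact this
    exact (Subgroup.normalClosure_le_normal hsub) hx

@[simp] theorem evalHom_gen {G M : Type*} [Group G] [MulAction G M] (V : Set M)
    (g : ↥(Eset G V)) : evalHom G V (GGrp.gen G V g) = (g : G) := by
  simp [evalHom, GGrp.gen, FreeGroup.lift_apply_of]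


theorem mem_Eset_iff {G M : Type*} [Group G] [MulAction G M] {V : Set M} {g : G} :
    g ∈ Eset G V ↔ ∃ x ∈ V, g • x ∈ V := by
  constructor
  · rintro ⟨_, hx, y, hy, rfl⟩
    exact ⟨y, hy, hx⟩
  · rintro ⟨x, hx, hgx⟩
    exact ⟨g • x, hgx, x, hx, rfl⟩

theorem GGrp.gen_mul_gen {G M : Type*} [Group G] [MulAction G M] {V : Set M}
    (g h gh : ↥(Eset G V)) (hF : ((g : G), (h : G)) ∈ Fset G V) (hmul : (gh : G) = g * h) :
    GGrp.gen G V g * GGrp.gen G V h = GGrp.gen G V gh := by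
  rw [← mul_inv_eq_one]
  exact (QuotientGroup.eq_one_iff _).mpr
    (Subgroup.subset_normalClosure ⟨g, h, gh, hF, hmul, rfl⟩)

/-- `ψ_U^V` is surjective as soon as any two points `g • y` and `y` of `V` can be joined, inside
`V`, by two steps lying in `E(U)`. -/
theorem psi_surjective_of_factor {G M : Type*} [Group G] [MulAction G M] {U V : Set M}
    (hUV : U ⊆ V)
    (hfac : ∀ (g : G), ∀ y ∈ V, g • y ∈ V →
      ∃ a ∈ Eset G U, ∃ b ∈ Eset G U, a * b = g ∧ b • y ∈ V) :
    Function.Surjective (psi G hUV) := by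
  have hgen : ∀ g : ↥(Eset G V), GGrp.gen G V g ∈ (psi G hUV).range := by
    rintro ⟨g, hg⟩
    obtain ⟨y, hy, hgy⟩ := mem_Eset_iff.mp hg
    obtain ⟨a, ha, b, hb, rfl, hby⟩ := hfac g y hy hgy
    refine ⟨GGrp.gen G U ⟨a, ha⟩ * GGrp.gen G U ⟨b, hb⟩, ?_⟩
    rw [map_mul, psi_gen, psi_gen]
    refine GGrp.gen_mul_gen _ _ _ ⟨(a * b) • y, ⟨hgy, b • y, hby, ?_⟩, y, hy, rfl⟩ rfl
    exact smul_smul a b y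
  intro q
  obtain ⟨w, rfl⟩ := QuotientGroup.mk_surjective q
  change (w : GGrp G V) ∈ (psi G hUV).range
  induction w using FreeGroup.induction_on with
  | C1 => exact one_mem _
  | of g => exact hgen g
  | inv_of g hg => exact inv_mem hg
  | mul x y hx hy => exact mul_mem hx hy

/-- If `1 ∈ V ⊆ X ⊆ ⋃_{s ∈ V} V·s⁻¹` with `V` open and `G ≤ H` dense, then both
`ψ_{V'}^{X'} : 𝐆(G,V∩G) → 𝐆(G,X∩G)` and `ψ_V^X : 𝐆(G,V) → 𝐆(G,X)` are surjective. -/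
theorem psi_surjective_of_translates {H : Type*} [TopologicalSpace H] [Group H]
    [IsTopologicalGroup H]
    (G : Subgroup H) (hdense : Dense (G : Set H))
    {V X : Set H} (hVopen : IsOpen V) (h1V : (1 : H) ∈ V) (hVX : V ⊆ X)
    (hX : X ⊆ {x : H | ∃ v ∈ V, ∃ s ∈ V, x = v * s⁻¹}) :
    Function.Surjective
      (psi ↥G (Set.inter_subset_inter_left (G : Set H) hVX) :
        GGrp ↥G (V ∩ (G : Set H)) →* GGrp ↥G (X ∩ (G : Set H))) ∧
    Function.Surjective (psi ↥G hVX : GGrp ↥G V →* GGrp ↥G X) := by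
  refine ⟨psi_surjective_of_factor _ ?_, psi_surjective_of_factor _ ?_⟩
  · have key : ∀ x : G, (x : H) ∈ X → ∃ s ∈ G, s ∈ V ∧ (x : H) * s ∈ V := by
      intro x hx
      obtain ⟨v, hv, s, hs, hxs⟩ := hX hx
      have hopen : IsOpen (V ∩ (fun z => (x : H) * z) ⁻¹' V) :=
        hVopen.inter (hVopen.preimage (by fun_prop))
      obtain ⟨z, ⟨hz, hxz⟩, hzG⟩ := hdense.inter_open_nonempty _ hopen
        ⟨s, hs, by simpa [hxs] using hv⟩
      exact ⟨z, hzG, hz, hxz⟩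
    rintro g y ⟨hy, hyG⟩ ⟨hgy, hgyG⟩
    lift y to G using hyG
    obtain ⟨s, hsG, hs, hxs⟩ := key (g * y) hgy
    obtain ⟨t, htG, ht, hyt⟩ := key y hy
    refine ⟨g * y, mem_Eset_iff.mpr ⟨s, ⟨hs, hsG⟩, hxs, mul_mem (g * y).2 hsG⟩,
      y⁻¹, mem_Eset_iff.mpr ⟨y * t, ⟨hyt, mul_mem y.2 htG⟩, ?_⟩, by group, ?_⟩
    · simpa [Subgroup.smul_def] using ⟨ht, htG⟩
    · simpa [Subgroup.smul_def] using hVX h1V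
  · intro g y hy hgy
    obtain ⟨v, hv, s, hs, hxs⟩ := hX hgy
    obtain ⟨w, hw, t, ht, hyt⟩ := hX hy
    have hopen : IsOpen ((fun b => b * y) ⁻¹' V ∩ (fun b => b * y * s) ⁻¹' V ∩
        (fun b => b * y * t) ⁻¹' V) :=
      ((hVopen.preimage (by fun_prop)).inter (hVopen.preimage (by fun_prop))).inter
        (hVopen.preimage (by fun_prop))
    obtain ⟨b, ⟨⟨hb, hbs⟩, hbt⟩, hbG⟩ := hdense.inter_open_nonempty _ hopen
      ⟨y⁻¹, by simp [h1V, hs, ht]⟩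
    lift b to G using hbG
    refine ⟨g * b⁻¹, mem_Eset_iff.mpr ⟨b * y * s, hbs, ?_⟩, b,
      mem_Eset_iff.mpr ⟨w, hw, ?_⟩, by group, hVX hb⟩
    · have hv' : (g : H) * y * s = v := by
        rw [show (g : H) * y = v * s⁻¹ from hxs, inv_mul_cancel_right]
      simpa [Subgroup.smul_def, mul_assoc, ← hv'] using hv
    · simpa [Subgroup.smul_def, hyt, mul_assoc] using hbt
end

section
/- Let H be a Hausdorff abelian topological group (written additively) which is locally compact, connected and simply connected, and let Λ be a subgroup of ℝ^d × H such that the quotient group (ℝ^d × H)/Λ is compact. Let π and π' be the projections of ℝ^d × H onto ℝ^d and H respectively, and assume: π restricted to Λ is injective; π' restricted to Λ is injective; G = π'(Λ) is dense in H. Let K ⊆ H be nonempty with compact closure and equal to the closure of its interior, and suppose there is a set V ⊆ H with 0 ∈ V ⊆ K, V open and path-connected, such that every k ∈ K satisfies k + s ∈ V for some s ∈ V (i.e. K ⊆ ⋃_{s∈V}(V − s)). Let D_K = {π(x) : x ∈ Λ, π'(x) ∈ K} ⊆ ℝ^d be the associated model set. Then the group G_{D_K} (the universal group of the point-set semigroup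 of D_K) is isomorphic to G = π'(Λ). -/
open Pointwise

/-- The relators `(x−y)·(y−z)·((x−z))⁻¹`, `x, y, z ∈ D`, as elements of the free group on
the set of difference vectors `D − D`. -/
def pointRelators {E : Type*} [AddGroup E] (D : Set E) : Set (FreeGroup ↥(D - D)) :=
  {r | ∃ (x y z : E) (hx : x ∈ D) (hy : y ∈ D) (hz : z ∈ D),
    r = FreeGroup.of (⟨x - y, Set.sub_mem_sub hx hy⟩ : ↥(D - D)) *
        FreeGroup.of (⟨y - z, Set.sub_mem_sub hy hz⟩ : ↥(D - D)) *
        (FreeGroup.of (⟨x - z, Set.sub_mem_sub hx hz⟩ : ↥(D - D)))⁻¹}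

/-- The group `G_D`, the universal group of the point-set semigroup of `D`: the free group
on `D − D` modulo the normal closure of the relators. -/
abbrev GD {E : Type*} [AddGroup E] (D : Set E) : Type _ :=
  FreeGroup ↥(D - D) ⧸ Subgroup.normalClosure (pointRelators D)

/-- In a covering of a simply connected space, joined points of the same fibre coincide. -/
theorem IsCoveringMap.eq_of_joined {E X : Type*} [TopologicalSpace E] [TopologicalSpace X]
    [SimplyConnectedSpace X] {p : E → X} (cov : IsCoveringMap p) {e e' : E} (h : Joined e e')
    (hp : p e = p e') : e = e' := by
  obtain ⟨γ⟩ := h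
  have h := cov.liftPath_apply_one_eq_of_homotopicRel
    (SimplyConnectedSpace.paths_homotopic ((γ.map cov.continuous).cast rfl hp) (Path.refl (p e)))
    e (by simp) (by simp)
  have hγ : γ.toContinuousMap = cov.liftPath
      ((γ.map cov.continuous).cast rfl hp).toContinuousMap e (by simp) :=
    (cov.eq_liftPath_iff' _).mpr ⟨rfl, γ.source⟩
  have hrefl : cov.liftPath (Path.refl (p e)).toContinuousMap e (by simp) = .const _ e :=
    cov.liftPath_const rfl
  rw [← hγ, hrefl] at h
  simpa using h.symm

/-- In a covering of a path-connected space, every point of the total space is joined to every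
fibre. -/
theorem IsCoveringMap.exists_joined {E X : Type*} [TopologicalSpace E] [TopologicalSpace X]
    [PathConnectedSpace X] {p : E → X} (cov : IsCoveringMap p) (e : E) (x : X) :
    ∃ e', p e' = x ∧ Joined e e' := by
  let γ := PathConnectedSpace.somePath (p e) x
  have hγ := cov.liftPath_lifts γ.toContinuousMap e γ.source
  refine ⟨cov.liftPath γ.toContinuousMap e γ.source 1, ?_,
    ⟨⟨cov.liftPath γ.toContinuousMap e γ.source, cov.liftPath_zero _ _ _, rfl⟩⟩⟩
  simpa using congrFun hγ 1

/-- An additive subgroup whose elements include all those mapped into a neighbourhood of zero of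
a connected group by a homomorphism with dense range is the whole group. -/
theorem AddSubgroup.eq_top_of_forall_mem_of_denseRange {A H : Type*} [AddCommGroup A]
    [AddCommGroup H] [TopologicalSpace H] [IsTopologicalAddGroup H] [ConnectedSpace H]
    {ι : A →+ H} (hι : DenseRange ι) {V : Set H} (hV : IsOpen V) (h0 : (0 : H) ∈ V)
    {S : AddSubgroup A} (hS : ∀ a, ι a ∈ V → a ∈ S) : S = ⊤ := by
  have hsub : V ⊆ (S.map ι).topologicalClosure := by
    intro x hx
    refine mem_closure_iff.mpr fun O hO hxO ↦ ?_
    obtain ⟨a, ha⟩ := hι.exists_mem_open (hO.inter hV) ⟨x, hxO, hx⟩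
    exact ⟨ι a, ha.1, a, hS a ha.2, rfl⟩
  have hopen : IsOpen ((S.map ι).topologicalClosure : Set H) :=
    AddSubgroup.isOpen_of_mem_nhds _ (g := 0) (Filter.mem_of_superset (hV.mem_nhds h0) hsub)
  have huniv := IsClopen.eq_univ ⟨(S.map ι).isClosed_topologicalClosure, hopen⟩
    ⟨0, zero_mem (S.map ι).topologicalClosure⟩
  refine (AddSubgroup.eq_top_iff' S).mpr fun a ↦ ?_
  have ha : ι a ∈ _root_.closure (S.map ι : Set H) := by
    have := Set.mem_univ (ι a)
    rw [← huniv] at this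
    exact this
  obtain ⟨_, hy, b, hb, rfl⟩ := mem_closure_iff.mp ha ((fun y ↦ ι a - y) ⁻¹' V)
    (hV.preimage (by fun_prop)) (show ι a - ι a ∈ V by simpa using h0)
  have := S.add_mem (hS (a - b) (by simpa using hy)) hb
  simpa using this

section LocalHom

variable {A H Γ : Type*} [AddCommGroup A] [AddCommGroup H] [TopologicalSpace H]
  [IsTopologicalAddGroup H] [Group Γ] [TopologicalSpace Γ] [DiscreteTopology Γ]

/-- The bundle with discrete fibre `Γ` and charts the translates of `W` by elements of `A`, glued
by a map `f : A → Γ` multiplicative on `V ⊇ W - W`. -/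
def localHomBundle (ι : A →+ H) (f : A → Γ) (V W : Set H) (hW : IsOpen W)
    (hWV : ∀ x ∈ W, ∀ y ∈ W, x - y ∈ V) (h1 : f 0 = 1)
    (hf : ∀ a b, ι a ∈ V → ι b ∈ V → ι (a + b) ∈ V → f (a + b) = f a * f b)
    (idx : H → A) (hidx : ∀ x, x - ι (idx x) ∈ W) : FiberBundleCore A H Γ where
  baseSet a := {x | x - ι a ∈ W}
  isOpen_baseSet a := hW.preimage (by fun_prop)
  indexAt := idx
  mem_baseSet_at := hidx
  coordChange a b _ v := v * f (b - a)
  coordChange_self a x _ v := by simp [h1]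
  continuousOn_coordChange a b :=
    ((continuous_of_discreteTopology (f := fun v : Γ ↦ v * f (b - a))).comp
      continuous_snd).continuousOn
  coordChange_comp a b c x hx v := by
    obtain ⟨⟨ha, hb⟩, hc⟩ := hx
    have key : ∀ {a b : A}, x - ι a ∈ W → x - ι b ∈ W → ι (b - a) ∈ V := fun {a b} ha hb ↦ by
      have := hWV _ ha _ hb
      rwa [sub_sub_sub_cancel_left, ← map_sub] at this
    have hadd : (b - a) + (c - b) = c - a := by abel
    have := hf (b - a) (c - b) (key ha hb) (key hb hc) (hadd ▸ key ha hc)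
    rw [mul_assoc, ← this, hadd]

variable {ι : A →+ H} {f : A → Γ} {V W : Set H} {hW : IsOpen W}
    {hWV : ∀ x ∈ W, ∀ y ∈ W, x - y ∈ V} {h1 : f 0 = 1}
    {hf : ∀ a b, ι a ∈ V → ι b ∈ V → ι (a + b) ∈ V → f (a + b) = f a * f b}
    {idx : H → A} {hidx : ∀ x, x - ι (idx x) ∈ W}

/-- The points of `localHomBundle` with coordinate `v` over `ι a` in the chart `a` and with
coordinate `v * f b` over `ι (a + b)` in the chart `a + b` are joined, for `b` in `V`. -/
theorem joined_localHomBundle (hι : DenseRange ι) (h0W : (0 : H) ∈ W) (hV : IsOpen V)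
    (h0V : (0 : H) ∈ V) (hVpc : IsPathConnected V) (a b : A) (hb : ι b ∈ V) (v : Γ) :
    Joined (X := (localHomBundle ι f V W hW hWV h1 hf idx hidx).TotalSpace)
      ⟨ι a, v * f (idx (ι a) - a)⟩ ⟨ι (a + b), v * f b * f (idx (ι (a + b)) - (a + b))⟩ := by
  let Z := localHomBundle ι f V W hW hWV h1 hf idx hidx
  obtain ⟨δ, hδ⟩ := hVpc.joinedIn 0 h0V (ι b) hb
  have indep : ∀ (x : H) (c c' : A), ι c ∈ V → ι c' ∈ V → x - ι (a + c) ∈ W →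
      x - ι (a + c') ∈ W →
      v * f c * f (idx x - (a + c)) = v * f c' * f (idx x - (a + c')) := by
    intro x c c' hc hc' hx hx'
    have h := Z.coordChange_comp (a + c) (a + c') (idx x) x ⟨⟨hx, hx'⟩, hidx x⟩ (v * f c)
    change v * f c * f (a + c' - (a + c)) * f (idx x - (a + c')) =
      v * f c * f (idx x - (a + c)) at h
    have hcc : c + (c' - c) = c' := by abel
    have hmem : ι (c' - c) ∈ V := by
      have := hWV _ hx _ hx'
      rwa [sub_sub_sub_cancel_left, ← map_sub, add_sub_add_left_eq_sub] at this
    have hfc := hf c (c' - c) hc hmem (hcc.symm ▸ hc')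
    rw [hcc] at hfc
    rw [← h, add_sub_add_left_eq_sub, hfc, mul_assoc v]
  have hex : ∀ t, ∃ c, ι c ∈ V ∧ ι a + δ t - ι (a + c) ∈ W := fun t ↦ by
    obtain ⟨c, hc⟩ := hι.exists_mem_open
      (hV.inter (hW.preimage (f := fun y ↦ δ t - y) (by fun_prop))) ⟨δ t, hδ t, by simpa using h0W⟩
    exact ⟨c, hc.1, by simpa [add_sub_add_left_eq_sub] using hc.2⟩
  choose c hcV hcW using hex
  let L : unitInterval → Z.TotalSpace := fun t ↦
    ⟨ι a + δ t, v * f (c t) * f (idx (ι a + δ t) - (a + c t))⟩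
  have hL : Continuous L := by
    refine continuous_iff_continuousAt.mpr fun t ↦ ?_
    have hcont : ContinuousAt (fun s ↦ (Z.localTriv (a + c t)).toOpenPartialHomeomorph.symm
        (ι a + δ s, v * f (c t))) t := by
      refine ContinuousAt.comp (f := fun s ↦ (ι a + δ s, v * f (c t)))
        (OpenPartialHomeomorph.continuousAt_symm _ ?_) (by fun_prop)
      exact (Bundle.Trivialization.mem_target _).mpr (hcW t)
    refine hcont.congr ?_
    have hopen : IsOpen {s | ι a + δ s - ι (a + c t) ∈ W} := hW.preimage (by fun_prop)
    filter_upwards [hopen.mem_nhds (hcW t)] with s hs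
    exact congrArg (Bundle.TotalSpace.mk (F := Γ) (E := Z.Fiber) (ι a + δ s))
      (indep _ _ _ (hcV t) (hcV s) hs (hcW s))
  have mk_congr : ∀ {x y : H} (u : H → Γ), x = y →
      (⟨x, u x⟩ : Z.TotalSpace) = ⟨y, u y⟩ := by
    rintro x _ u rfl; rfl
  refine ⟨⟨⟨L, hL⟩, ?_, ?_⟩⟩
  · have h := indep (ι a + δ 0) (c 0) 0 (hcV 0) (by simpa using h0V) (hcW 0) (by simpa using h0W)
    simp only [h1, mul_one, add_zero] at h
    refine (congrArg (Bundle.TotalSpace.mk (F := Γ) (E := Z.Fiber) (ι a + δ 0)) h).trans ?_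
    exact mk_congr (fun x ↦ v * f (idx x - a)) (by simp)
  · have h := indep (ι a + δ 1) (c 1) b (hcV 1) hb (hcW 1) (by simpa using h0W)
    refine (congrArg (Bundle.TotalSpace.mk (F := Γ) (E := Z.Fiber) (ι a + δ 1)) h).trans ?_
    exact mk_congr (fun x ↦ v * f b * f (idx x - (a + b))) (by simp)

end LocalHom

/-- Monodromy principle: a map multiplicative on the part of `A` lying, via a homomorphism of dense
range, in an open path-connected neighbourhood of zero of a simply connected group extends from
there to a homomorphism. -/
theorem exists_monoidHom_eq_of_local_hom {A H Γ : Type*} [AddCommGroup A] [AddCommGroup H]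
    [TopologicalSpace H] [IsTopologicalAddGroup H] [SimplyConnectedSpace H] [Group Γ]
    {ι : A →+ H} (hι : DenseRange ι) {V : Set H} (hV : IsOpen V) (h0V : (0 : H) ∈ V)
    (hVpc : IsPathConnected V) (f : A → Γ)
    (hf : ∀ a b, ι a ∈ V → ι b ∈ V → ι (a + b) ∈ V → f (a + b) = f a * f b) :
    ∃ F : Multiplicative A →* Γ, ∀ a, ι a ∈ V → F (Multiplicative.ofAdd a) = f a := by
  let _ : TopologicalSpace Γ := ⊥
  have : DiscreteTopology Γ := ⟨rfl⟩
  have h1 : f 0 = 1 := by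
    have := hf 0 0 (by simpa) (by simpa) (by simpa)
    simpa using this
  obtain ⟨W, hW, h0W, hWV⟩ : ∃ W : Set H, IsOpen W ∧ 0 ∈ W ∧ ∀ x ∈ W, ∀ y ∈ W, x - y ∈ V := by
    have hO : IsOpen ((fun p : H × H ↦ p.1 - p.2) ⁻¹' V) := hV.preimage (by fun_prop)
    obtain ⟨u, v, hu, hv, h0u, h0v, huv⟩ := isOpen_prod_iff.mp hO 0 0 (by simpa using h0V)
    exact ⟨u ∩ v, hu.inter hv, ⟨h0u, h0v⟩, fun x hx y hy ↦ huv (Set.mk_mem_prod hx.1 hy.2)⟩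
  have hidx : ∀ x, ∃ a, x - ι a ∈ W := fun x ↦
    hι.exists_mem_open (hW.preimage (f := fun y ↦ x - y) (by fun_prop)) ⟨x, by simpa using h0W⟩
  choose idx hidx using hidx
  let Z := localHomBundle ι f V W hW hWV h1 hf idx hidx
  have cov : IsCoveringMap Z.proj := FiberBundle.isCoveringMap (F := Γ) (E := Z.Fiber)
  let pt : A → Γ → Z.TotalSpace := fun a v ↦ ⟨ι a, v * f (idx (ι a) - a)⟩
  have hpt : ∀ a (e : Z.TotalSpace), Z.proj e = ι a → ∃ v, e = pt a v := by
    rintro a ⟨x, v⟩ rfl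
    have hv (v c : Γ) : v = v * c⁻¹ * c := by simp
    exact ⟨_, congrArg (Bundle.TotalSpace.mk (F := Γ) (E := Z.Fiber) (ι a)) (hv v _)⟩
  have pt_inj : ∀ a v v', pt a v = pt a v' → v = v' := fun a v v' h ↦
    mul_right_cancel (Bundle.TotalSpace.mk_injective (F := Γ) (E := Z.Fiber) (ι a) h)
  have hex : ∀ a, ∃ v, Joined (pt 0 1) (pt a v) := fun a ↦ by
    obtain ⟨e, he, hj⟩ := cov.exists_joined (pt 0 1) (ι a)
    obtain ⟨v, rfl⟩ := hpt a e he
    exact ⟨v, hj⟩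
  choose F hF using hex
  have huniq : ∀ a v, Joined (pt 0 1) (pt a v) → v = F a := fun a v hv ↦
    pt_inj a _ _ (cov.eq_of_joined (hv.symm.trans (hF a)) rfl)
  have F_zero : F 0 = 1 := (huniq 0 1 (.refl _)).symm
  have F_add : ∀ a b, ι b ∈ V → F (a + b) = F a * f b := fun a b hb ↦
    (huniq _ _ ((hF a).trans (joined_localHomBundle hι h0W hV h0V hVpc a b hb (F a)))).symm
  have F_eq : ∀ b, ι b ∈ V → F b = f b := fun b hb ↦ by
    simpa [F_zero] using F_add 0 b hb
  let S : AddSubgroup A :=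
    { carrier := {b | ∀ a, F (a + b) = F a * F b}
      zero_mem' := fun a ↦ by simp [F_zero]
      add_mem' := fun {b c} hb hc a ↦ by
        rw [← add_assoc, hc, hb, hc b, mul_assoc]
      neg_mem' := fun {b} hb a ↦ by
        have h₁ := hb (a + -b)
        have h₂ := hb (-b)
        rw [neg_add_cancel, F_zero] at h₂
        rw [neg_add_cancel_right] at h₁
        rw [h₁, eq_inv_of_mul_eq_one_left h₂.symm, mul_inv_cancel_right] }
  have hS : S = ⊤ := AddSubgroup.eq_top_of_forall_mem_of_denseRange hι hV h0V fun b hb a ↦ by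
    rw [F_add a b hb, F_eq b hb]
  refine ⟨⟨⟨fun a ↦ F a.toAdd, F_zero⟩, fun a b ↦ ?_⟩, fun a ha ↦ F_eq a ha⟩
  exact (hS ▸ AddSubgroup.mem_top b.toAdd : b.toAdd ∈ S) a.toAdd

/-- Main theorem: for a model set `D_K` coming from a cut-and-projection scheme
`(K, G = π'(Λ), H)` with `H` locally compact, connected, simply connected abelian,
`Λ ≤ ℝ^d × H` cocompact, `π|_Λ`, `π'|_Λ` injective, `G = π'(Λ)` dense in `H`, `K` nonempty,
relatively compact and the closure of its interior, and `K` admitting an open path-connected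
`V` with `0 ∈ V ⊆ K ⊆ ⋃_{s∈V}(V − s)`, the universal group `G_{D_K}` of the point-set
semigroup of `D_K` is isomorphic to `G = π'(Λ)`. -/
theorem GD_modelSet_iso {d : ℕ} {H : Type*} [AddCommGroup H] [TopologicalSpace H]
    [IsTopologicalAddGroup H] [T2Space H] [LocallyCompactSpace H]
    [ConnectedSpace H] [SimplyConnectedSpace H]
    (Λ : AddSubgroup (EuclideanSpace ℝ (Fin d) × H))
    (hcocompact : CompactSpace ((EuclideanSpace ℝ (Fin d) × H) ⧸ Λ))
    (hπinj : Set.InjOn Prod.fst (Λ : Set (EuclideanSpace ℝ (Fin d) × H)))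
    (hπ'inj : Set.InjOn Prod.snd (Λ : Set (EuclideanSpace ℝ (Fin d) × H)))
    (hdense : Dense (Prod.snd '' (Λ : Set (EuclideanSpace ℝ (Fin d) × H))))
    (K : Set H) (hKne : K.Nonempty) (hKbdd : IsCompact (closure K))
    (hKreg : K = closure (interior K))
    (V : Set H) (h0V : (0 : H) ∈ V) (hVK : V ⊆ K) (hVopen : IsOpen V)
    (hVpc : IsPathConnected V)
    (hKV : ∀ k ∈ K, ∃ s ∈ V, k + s ∈ V) :
    Nonempty (GD {y : EuclideanSpace ℝ (Fin d) |
        ∃ x ∈ Λ, Prod.snd x ∈ K ∧ y = Prod.fst x} ≃*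
      Multiplicative ↥(Λ.map (AddMonoidHom.snd (EuclideanSpace ℝ (Fin d)) H))) := by
  let D := {y : EuclideanSpace ℝ (Fin d) | ∃ x ∈ Λ, Prod.snd x ∈ K ∧ y = Prod.fst x}
  let ι : Λ →+ H := (AddMonoidHom.snd _ H).comp Λ.subtype
  have hι : DenseRange ι := by
    have : Set.range ι = Prod.snd '' (Λ : Set (EuclideanSpace ℝ (Fin d) × H)) := by
      ext x; simp [ι]
    rwa [DenseRange, this]
  have fst_inj {a b : Λ} (h : a.1.1 = b.1.1) : a = b := Subtype.ext (hπinj a.2 b.2 h)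
  have memD (a : Λ) (ha : ι a ∈ K) : a.1.1 ∈ D := ⟨a.1, a.2, ha, rfl⟩
  have hK0 : ι 0 ∈ K := hVK (by simpa using h0V)
  classical
  let q : EuclideanSpace ℝ (Fin d) → GD D := fun u ↦
    if h : u ∈ D - D then QuotientGroup.mk (FreeGroup.of ⟨u, h⟩) else 1
  have q_mem (u : ↥(D - D)) : q u = QuotientGroup.mk (FreeGroup.of u) := dif_pos u.2
  have q_mul {x y z : EuclideanSpace ℝ (Fin d)} (hx : x ∈ D) (hy : y ∈ D) (hz : z ∈ D) :
      q (x - y) * q (y - z) = q (x - z) := by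
    have h := (QuotientGroup.eq_one_iff _).mpr
      (Subgroup.subset_normalClosure ⟨x, y, z, hx, hy, hz, rfl⟩ :
        _ ∈ Subgroup.normalClosure (pointRelators D))
    rw [q_mem ⟨_, Set.sub_mem_sub hx hy⟩, q_mem ⟨_, Set.sub_mem_sub hy hz⟩,
      q_mem ⟨_, Set.sub_mem_sub hx hz⟩]
    exact mul_inv_eq_one.mp h
  have q_sub_mul (a b : Λ) (ha : ι a ∈ K) (hb : ι b ∈ K) :
      q (a - b : Λ).1.1 * q b.1.1 = q a.1.1 := by
    simpa using q_mul (memD a ha) (memD b hb) (memD 0 hK0)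
  obtain ⟨F, hFV⟩ := exists_monoidHom_eq_of_local_hom hι hVopen h0V hVpc (fun a : Λ ↦ q a.1.1)
    fun a b ha hb hab ↦ by simpa using (q_sub_mul (a + b) b (hVK hab) (hVK hb)).symm
  have hFK (a : Λ) (ha : ι a ∈ K) : F (.ofAdd a) = q a.1.1 := by
    obtain ⟨s₀, hs₀, has₀⟩ := hKV _ ha
    obtain ⟨s, hs, has⟩ := hι.exists_mem_open
      (hVopen.inter (hVopen.preimage (f := fun y ↦ ι a + y) (by fun_prop))) ⟨s₀, hs₀, has₀⟩
    have has' : ι (a + s) ∈ V := by simpa using has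
    have h := q_sub_mul (a + s) s (hVK has') (hVK hs)
    rw [add_sub_cancel_right, ← hFV _ has', ← hFV _ hs, ofAdd_add, map_mul] at h
    exact (mul_right_cancel h).symm
  have hF_sub (a b : Λ) (ha : ι a ∈ K) (hb : ι b ∈ K) :
      F (.ofAdd (a - b)) = q (a - b : Λ).1.1 := by
    have h := q_sub_mul a b ha hb
    rw [← hFK a ha, ← hFK b hb] at h
    rw [ofAdd_sub, map_div, ← h, mul_div_cancel_right]
  have hc (u : ↥(D - D)) : ∃ a b : Λ, ι a ∈ K ∧ ι b ∈ K ∧ (a - b : Λ).1.1 = u := by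
    obtain ⟨_, _, ⟨x, hx, hxK, rfl⟩, _, ⟨y, hy, hyK, rfl⟩, rfl⟩ := u
    exact ⟨⟨x, hx⟩, ⟨y, hy⟩, hxK, hyK, rfl⟩
  choose c c' hcK hcK' hc using hc
  let φ : FreeGroup ↥(D - D) →* Multiplicative Λ := FreeGroup.lift fun u ↦ .ofAdd (c u - c' u)
  have hφ : Subgroup.normalClosure (pointRelators D) ≤ φ.ker := by
    refine Subgroup.normalClosure_le_normal ?_
    rintro _ ⟨x, y, z, hx, hy, hz, rfl⟩
    have h : (c ⟨_, Set.sub_mem_sub hx hy⟩ - c' ⟨_, Set.sub_mem_sub hx hy⟩) +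
        (c ⟨_, Set.sub_mem_sub hy hz⟩ - c' ⟨_, Set.sub_mem_sub hy hz⟩) =
        c ⟨_, Set.sub_mem_sub hx hz⟩ - c' ⟨_, Set.sub_mem_sub hx hz⟩ := by
      refine fst_inj ?_
      rw [hc, AddSubgroup.coe_add, Prod.fst_add, hc, hc, sub_add_sub_cancel]
    simp only [SetLike.mem_coe, MonoidHom.mem_ker, map_mul, map_inv, φ, FreeGroup.lift_apply_of]
    rw [mul_inv_eq_one, ← ofAdd_add, h]
  let Φ : GD D →* Multiplicative Λ := QuotientGroup.lift _ φ hφ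
  have hΦq (a : Λ) (ha : a.1.1 ∈ D - D) : Φ (q a.1.1) = .ofAdd a := by
    rw [q_mem ⟨_, ha⟩]
    change φ (FreeGroup.of ⟨_, ha⟩) = _
    rw [FreeGroup.lift_apply_of, fst_inj (hc ⟨_, ha⟩)]
  have hΦF : Φ.comp F = MonoidHom.id _ := by
    let S : AddSubgroup Λ := Subgroup.toAddSubgroup' ((Φ.comp F).eqLocus (MonoidHom.id _))
    have hS : S = ⊤ := AddSubgroup.eq_top_of_forall_mem_of_denseRange hι hVopen h0V fun a ha ↦ by
      change Φ (F (.ofAdd a)) = .ofAdd a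
      rw [hFV a ha]
      exact hΦq a (by simpa using Set.sub_mem_sub (memD a (hVK ha)) (memD 0 hK0))
    refine MonoidHom.ext fun a ↦ ?_
    exact (hS ▸ AddSubgroup.mem_top a.toAdd : a.toAdd ∈ S)
  have hFΦ : F.comp Φ = MonoidHom.id _ := by
    refine QuotientGroup.monoidHom_ext _ (FreeGroup.ext_hom _ _ fun u ↦ ?_)
    change F (φ (FreeGroup.of u)) = QuotientGroup.mk (FreeGroup.of u)
    rw [FreeGroup.lift_apply_of, hF_sub _ _ (hcK u) (hcK' u), hc, q_mem]
  let e : Λ ≃+ Λ.map (AddMonoidHom.snd (EuclideanSpace ℝ (Fin d)) H) :=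
    AddEquiv.ofBijective ((AddMonoidHom.snd _ H).addSubgroupMap Λ)
      ⟨fun a b h ↦ Subtype.ext (hπ'inj a.2 b.2 (congrArg Subtype.val h)),
        AddMonoidHom.addSubgroupMap_surjective _ _⟩
  exact ⟨(MonoidHom.toMulEquiv Φ F hFΦ hΦF).trans e.toMultiplicative⟩
end
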